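/- arXiv:2104.12740 — 2 statements merged into one kernel-verified Lean document; each statement's English description precedes it below -/
import Mathlib

section
/- Let S be a positive Markov martingale with kernel K. Define a(x) := K(x,[0,x)) and assume there exists x_a > 0 such that inf_{x∈[x_a,y]} a(x) > 0 for all y > x_a. Then for every x' ≥ x_a, every starting point x > 0, and every k ∈ ℕ: lim_{n→∞} E_x[S_∞ 1_{{x' ≤ S_k ≤ S_{k+1} ≤ ⋯ ≤ S_n}}] = 0. Consequently S is a bubble under P_x if and only if there exists k with lim_{n→∞} E_x[S_n 1_{{x' ≤ S_k ≤ ⋯ ≤ S_n}}] > 0. -/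
open MeasureTheory Filter Set

noncomputable section

variable {Ω : Type*}

/-- Evaluation of a discrete-time process at a possibly infinite random time `τ`,
using the limit variable `Sinf` on the event `{τ = ∞}`. -/
def evalAt (S : ℕ → Ω → ℝ) (Sinf : Ω → ℝ) (τ : Ω → ℕ∞) (ω : Ω) : ℝ :=
  if τ ω = ⊤ then Sinf ω else S (τ ω).toNat ω

/-- The `k`-th drawdown time of `S`: `τ₀ = 0` and
`τ_k = inf {j > τ_{k-1} : S_j < S_{j-1}}` (with value `∞` if no such `j` exists). -/
def drawdown (S : ℕ → Ω → ℝ) : ℕ → Ω → ℕ∞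
  | 0 => fun _ => 0
  | (k + 1) => fun ω =>
      sInf {j : ℕ∞ | drawdown S k ω < j ∧ ∃ n : ℕ, j = (n : ℕ∞) ∧ S n ω < S (n - 1) ω}

/-- The first drawdown of `S` after the deterministic time `k`:
`τ̃_k = inf {j > k : S_j < S_{j-1}}`. -/
def drawdownAfter (S : ℕ → Ω → ℝ) (k : ℕ) (ω : Ω) : ℕ∞ :=
  sInf {j : ℕ∞ | (k : ℕ∞) < j ∧ ∃ n : ℕ, j = (n : ℕ∞) ∧ S n ω < S (n - 1) ω}

/-- The process stopped at a possibly infinite random time. -/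
def stoppedAt (S : ℕ → Ω → ℝ) (τ : Ω → ℕ∞) (n : ℕ) (ω : Ω) : ℝ :=
  S ((min (n : ℕ∞) (τ ω)).toNat) ω

/-- The event `{S_k ≤ S_{k+1} ≤ ⋯ ≤ S_n}`. -/
def monoEvent (S : ℕ → Ω → ℝ) (k n : ℕ) : Set Ω :=
  {ω | ∀ j, k ≤ j → j < n → S j ω ≤ S (j + 1) ω}

/-- `S` is a bubble under `P`: it loses mass at its `k`-th drawdown time for some `k ≥ 1`. -/
def IsBubble [MeasurableSpace Ω] (S : ℕ → Ω → ℝ) (Sinf : Ω → ℝ) (P : Measure Ω) : Prop :=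
  ∃ k : ℕ, ∫ ω, evalAt S Sinf (drawdown S (k + 1)) ω ∂P < ∫ ω, S 0 ω ∂P

end

noncomputable section

open ProbabilityTheory

/-- A positive time-homogeneous Markov martingale on `(0, ∞)` with transition kernel `K`,
together with its family of laws `P x` (start at `x`) and the a.s. limit `Sinf`. -/
structure MarkovMartingale (Ω : Type*) [m0 : MeasurableSpace Ω] where
  P : ℝ → Measure Ω
  F : Filtration ℕ m0
  S : ℕ → Ω → ℝ
  Sinf : Ω → ℝ
  K : Kernel ℝ ℝ
  markov : IsMarkovKernel K
  prob : ∀ x, 0 < x → IsProbabilityMeasure (P x)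
  pos : ∀ x, 0 < x → ∀ᵐ ω ∂P x, ∀ n, 0 < S n ω
  start : ∀ x, 0 < x → ∀ᵐ ω ∂P x, S 0 ω = x
  mart : ∀ x, 0 < x → Martingale S F (P x)
  conv : ∀ x, 0 < x → ∀ᵐ ω ∂P x, Tendsto (fun n => S n ω) atTop (nhds (Sinf ω))
  kernel_pos : ∀ x, 0 < x → K x (Set.Iic 0) = 0
  kernel_int : ∀ x, 0 < x → Integrable id (K x)
  kernel_mart : ∀ x, 0 < x → ∫ y, y ∂(K x) = x
  step : ∀ x, 0 < x → ∀ n : ℕ, ∀ g : ℝ → ℝ, Measurable g → (∃ C, ∀ y, |g y| ≤ C) →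
    (P x)[fun ω => g (S (n + 1) ω) | F n] =ᵐ[P x] fun ω => ∫ y, g y ∂(K (S n ω))

namespace MarkovMartingale

variable {Ω : Type*} [MeasurableSpace Ω]

/-- The probability `a(x) = K(x, [0,x))` of a downward move from `x`. -/
def a (M : MarkovMartingale Ω) (x : ℝ) : ℝ := (M.K x (Set.Ico 0 x)).toReal

/-- The relative recovery `b(x) = (1/x) ∫_{[0,x)} y K(x,dy)` upon a downward move. -/
def b (M : MarkovMartingale Ω) (x : ℝ) : ℝ := (1 / x) * ∫ y in Set.Ico 0 x, y ∂(M.K x)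

/-- The relaxed relative recovery `b_ε(x) = (1/x) ∫_{[0,x(1+ε))} y K(x,dy)`. -/
def bEps (M : MarkovMartingale Ω) (ε x : ℝ) : ℝ :=
  (1 / x) * ∫ y in Set.Ico 0 (x * (1 + ε)), y ∂(M.K x)

/-- `S` is a bubble under `P_x`. -/
def Bubble (M : MarkovMartingale Ω) (x : ℝ) : Prop := IsBubble M.S M.Sinf (M.P x)

/-- `S` is `P_x`-a.s. bounded. -/
def Bounded (M : MarkovMartingale Ω) (x : ℝ) : Prop :=
  ∃ C : ℝ, ∀ᵐ ω ∂M.P x, ∀ n, M.S n ω ≤ C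

/-- The default function `M_S(x) = x - E_x[S_{τ₁}]`, the loss of mass at the first
drawdown. -/
def defaultFn (M : MarkovMartingale Ω) (x : ℝ) : ℝ :=
  x - ∫ ω, evalAt M.S M.Sinf (drawdown M.S 1) ω ∂(M.P x)

/-- The assumption that the downward-move probability `a` is locally bounded away from zero
above a level `xa`. -/
def ALowerBound (M : MarkovMartingale Ω) (xa : ℝ) : Prop :=
  0 < xa ∧ ∀ y, xa < y → ∃ c > (0 : ℝ), ∀ x ∈ Set.Icc xa y, c ≤ M.a x

end MarkovMartingale

end

/-- Fatou's lemma for real-valued functions with bounded integrals. -/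
theorem integrable_and_integral_le_of_tendsto {Ω : Type*} [MeasurableSpace Ω] {P : Measure Ω}
    {f : ℕ → Ω → ℝ} {g : Ω → ℝ} {c : ℝ} (hf : ∀ n, Integrable (f n) P)
    (hnn : ∀ n, 0 ≤ᵐ[P] f n) (hlim : ∀ᵐ ω ∂P, Tendsto (fun n => f n ω) atTop (nhds (g ω)))
    (hc : ∀ n, ∫ ω, f n ω ∂P ≤ c) : Integrable g P ∧ ∫ ω, g ω ∂P ≤ c := by
  have hc0 : 0 ≤ c := (integral_nonneg_of_ae (hnn 0)).trans (hc 0)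
  have hgm : AEStronglyMeasurable g P :=
    aestronglyMeasurable_of_tendsto_ae atTop (fun n => (hf n).aestronglyMeasurable) hlim
  have hg0 : 0 ≤ᵐ[P] g := by
    filter_upwards [hlim, ae_all_iff.2 hnn] with ω h1 h2
    exact ge_of_tendsto' h1 h2
  have key : ∫⁻ ω, ENNReal.ofReal (g ω) ∂P ≤ ENNReal.ofReal c := by
    calc ∫⁻ ω, ENNReal.ofReal (g ω) ∂P
        = ∫⁻ ω, liminf (fun n => ENNReal.ofReal (f n ω)) atTop ∂P := by
          refine lintegral_congr_ae ?_
          filter_upwards [hlim] with ω h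
          exact ((ENNReal.continuous_ofReal.tendsto _).comp h).liminf_eq.symm
      _ ≤ liminf (fun n => ∫⁻ ω, ENNReal.ofReal (f n ω) ∂P) atTop :=
          lintegral_liminf_le' fun n => (hf n).aestronglyMeasurable.aemeasurable.ennreal_ofReal
      _ ≤ liminf (fun _ : ℕ => ENNReal.ofReal c) atTop := by
          refine liminf_le_liminf (Eventually.of_forall fun n => ?_)
          rw [← ofReal_integral_eq_lintegral_ofReal (hf n) (hnn n)]
          exact ENNReal.ofReal_le_ofReal (hc n)
      _ = ENNReal.ofReal c := liminf_const _
  refine ⟨⟨hgm, ?_⟩, ?_⟩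
  · rw [hasFiniteIntegral_iff_ofReal hg0]
    exact key.trans_lt ENNReal.ofReal_lt_top
  · rw [integral_eq_lintegral_of_nonneg_ae hg0 hgm]
    exact ENNReal.toReal_le_of_le_ofReal hc0 key

section Drawdown

variable {Ω : Type*} {S : ℕ → Ω → ℝ}

theorem drawdown_succ_le_iff {k n : ℕ} {ω : Ω} :
    drawdown S (k + 1) ω ≤ n ↔
      ∃ i < n, drawdown S k ω ≤ i ∧ ∃ j, i < j ∧ j ≤ n ∧ S j ω < S (j - 1) ω := by
  constructor
  · intro h
    have hne : {j : ℕ∞ | drawdown S k ω < j ∧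
        ∃ n : ℕ, j = (n : ℕ∞) ∧ S n ω < S (n - 1) ω}.Nonempty := by
      by_contra hempty
      rw [Set.not_nonempty_iff_eq_empty] at hempty
      simp [drawdown, hempty] at h
    obtain ⟨h1, j, h2, h3⟩ := csInf_mem hne
    change drawdown S (k + 1) ω = j at h2
    change drawdown S k ω < drawdown S (k + 1) ω at h1
    rw [h2] at h h1
    obtain ⟨i, hi⟩ := ENat.ne_top_iff_exists.1 (ne_top_of_lt h1)
    rw [← hi] at h1 ⊢
    have hij : i < j := by exact_mod_cast h1
    have hjn : j ≤ n := by exact_mod_cast h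
    exact ⟨i, hij.trans_le hjn, le_rfl, j, hij, hjn, h3⟩
  · rintro ⟨i, -, hi, j, hij, hjn, hj⟩
    have hlt : drawdown S k ω < j := hi.trans_lt (by exact_mod_cast hij)
    exact (sInf_le ⟨hlt, j, rfl, hj⟩ : drawdown S (k + 1) ω ≤ j).trans (by exact_mod_cast hjn)

theorem le_of_drawdown_le {k n : ℕ} {ω : Ω} (h : drawdown S k ω ≤ n) : k ≤ n := by
  induction k generalizing n with
  | zero => exact Nat.zero_le n
  | succ k ih =>
    obtain ⟨i, hi, h1, -⟩ := drawdown_succ_le_iff.1 h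
    have := ih h1
    omega

theorem monoEvent_subset_lt_drawdown (k n : ℕ) :
    monoEvent S k n ⊆ {ω | (n : ℕ∞) < drawdown S (k + 1) ω} := by
  intro ω hω
  change (n : ℕ∞) < drawdown S (k + 1) ω
  by_contra h
  obtain ⟨i, -, h1, j, hij, hjn, hj⟩ := drawdown_succ_le_iff.1 (not_lt.1 h)
  have hki := le_of_drawdown_le h1
  have := hω (j - 1) (by omega) (by omega)
  rw [Nat.sub_add_cancel (by omega)] at this
  exact absurd this (not_le.2 hj)

theorem lt_drawdown_succ_subset {k J n : ℕ} :
    {ω | (n : ℕ∞) < drawdown S (k + 1) ω} ⊆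
      {ω | (J : ℕ∞) < drawdown S k ω} ∪ monoEvent S J n := by
  intro ω hω
  by_contra h
  simp only [mem_union, mem_ofPred_eq, not_or, not_lt, monoEvent] at h
  obtain ⟨h1, h2⟩ := h
  push Not at h2
  obtain ⟨j, hj1, hj2, hj3⟩ := h2
  exact absurd (drawdown_succ_le_iff.2 ⟨J, by omega, h1, j + 1, by omega, by omega, by simpa⟩)
    (not_le.2 hω)

theorem monoEvent_subset_of_le {k J n : ℕ} (hkJ : k ≤ J) : monoEvent S k n ⊆ monoEvent S J n :=
  fun _ hω j h1 h2 => hω j (hkJ.trans h1) h2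

theorem monoEvent_antitone (k : ℕ) : Antitone (monoEvent S k) :=
  fun _ _ h _ hω j h1 h2 => hω j h1 (h2.trans_le h)

variable [m0 : MeasurableSpace Ω] {F : Filtration ℕ m0}

theorem measurableSet_drawdown_le (hS : StronglyAdapted F S) (k n : ℕ) :
    MeasurableSet[F n] {ω | drawdown S k ω ≤ n} := by
  induction k generalizing n with
  | zero => simp [drawdown]
  | succ k ih =>
    have : {ω | drawdown S (k + 1) ω ≤ n} =
        ⋃ i ∈ {i | i < n}, {ω | drawdown S k ω ≤ i} ∩
          ⋃ j ∈ {j | i < j ∧ j ≤ n}, {ω | S j ω < S (j - 1) ω} := by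
      ext ω
      simp only [mem_ofPred_eq, drawdown_succ_le_iff, mem_iUnion, mem_inter_iff, exists_prop,
        and_assoc]
    rw [this]
    refine MeasurableSet.biUnion (to_countable _) fun i hi => ?_
    refine (F.mono (le_of_lt hi) _ (ih i)).inter ?_
    refine MeasurableSet.biUnion (to_countable _) fun j hj => ?_
    exact measurableSet_lt ((hS.adapted j).mono (F.mono hj.2) le_rfl)
      ((hS.adapted (j - 1)).mono (F.mono (by have := hj.2; omega)) le_rfl)

theorem measurableSet_lt_drawdown (hS : StronglyAdapted F S) (k n : ℕ) :
    MeasurableSet[F n] {ω | (n : ℕ∞) < drawdown S k ω} := by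
  have := (measurableSet_drawdown_le hS k n).compl
  simpa only [compl_ofPred, not_le] using this

theorem measurableSet_monoEvent (hS : StronglyAdapted F S) (k n : ℕ) :
    MeasurableSet[F n] (monoEvent S k n) := by
  have : monoEvent S k n = ⋂ j ∈ {j | k ≤ j ∧ j < n}, {ω | S j ω ≤ S (j + 1) ω} := by
    ext ω
    simp only [monoEvent, mem_ofPred_eq, mem_iInter, and_imp]
  rw [this]
  refine MeasurableSet.biInter (to_countable _) fun j hj => ?_
  exact measurableSet_le ((hS.adapted j).mono (F.mono hj.2.le) le_rfl)
    ((hS.adapted (j + 1)).mono (F.mono hj.2) le_rfl)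

theorem measurableSet_level_le (hS : StronglyAdapted F S) (x' : ℝ) (k : ℕ) :
    MeasurableSet[F k] {ω | x' ≤ S k ω} :=
  hS.adapted k measurableSet_Ici

theorem measurableSet_lt_level (hS : StronglyAdapted F S) (x' : ℝ) (k : ℕ) :
    MeasurableSet[F k] {ω | S k ω < x'} :=
  hS.adapted k measurableSet_Iio

end Drawdown

section LossOfMass

variable {Ω : Type*} [m0 : MeasurableSpace Ω] {F : Filtration ℕ m0} {P : Measure Ω}
  [IsProbabilityMeasure P] {S : ℕ → Ω → ℝ} {Sinf : Ω → ℝ}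

theorem integrable_limit (hS : Martingale S F P) (hnn : ∀ᵐ ω ∂P, ∀ n, 0 ≤ S n ω)
    (hlim : ∀ᵐ ω ∂P, Tendsto (fun n => S n ω) atTop (nhds (Sinf ω))) : Integrable Sinf P := by
  refine (integrable_and_integral_le_of_tendsto (c := ∫ ω, S 0 ω ∂P) hS.integrable
    (fun n => hnn.mono fun ω h => h n) hlim fun n => ?_).1
  have := hS.setIntegral_eq (Nat.zero_le n) MeasurableSet.univ
  simp only [setIntegral_univ] at this
  exact this.ge

/-- The mass lost on `A` between time `n` and infinity is nonnegative. -/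
theorem setIntegral_sub_limit_nonneg (hS : Martingale S F P) (hnn : ∀ᵐ ω ∂P, ∀ n, 0 ≤ S n ω)
    (hlim : ∀ᵐ ω ∂P, Tendsto (fun n => S n ω) atTop (nhds (Sinf ω))) {n : ℕ} {A : Set Ω}
    (hA : MeasurableSet[F n] A) : 0 ≤ ∫ ω in A, (S n ω - Sinf ω) ∂P := by
  have hint := integrable_limit hS hnn hlim
  rw [integral_sub (hS.integrable n).integrableOn hint.integrableOn, sub_nonneg]
  refine (integrable_and_integral_le_of_tendsto (f := fun m => S (n + m))
    (fun m => (hS.integrable _).integrableOn)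
    (fun m => ae_restrict_of_ae (hnn.mono fun ω h => h _)) (ae_restrict_of_ae ?_) fun m => ?_).2
  · filter_upwards [hlim] with ω h
    exact (h.comp (tendsto_add_atTop_nat n)).congr fun m => by simp [add_comm]
  · exact (hS.setIntegral_eq (Nat.le_add_right n m) hA).ge

theorem setIntegral_sub_limit_eq (hS : Martingale S F P) (hnn : ∀ᵐ ω ∂P, ∀ n, 0 ≤ S n ω)
    (hlim : ∀ᵐ ω ∂P, Tendsto (fun n => S n ω) atTop (nhds (Sinf ω))) {m n : ℕ} (hmn : m ≤ n)
    {A : Set Ω} (hA : MeasurableSet[F m] A) :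
    ∫ ω in A, (S n ω - Sinf ω) ∂P = ∫ ω in A, (S m ω - Sinf ω) ∂P := by
  have hint := integrable_limit hS hnn hlim
  rw [integral_sub (hS.integrable n).integrableOn hint.integrableOn,
    integral_sub (hS.integrable m).integrableOn hint.integrableOn, hS.setIntegral_eq hmn hA]

theorem setIntegral_sub_limit_mono (hS : Martingale S F P) (hnn : ∀ᵐ ω ∂P, ∀ n, 0 ≤ S n ω)
    (hlim : ∀ᵐ ω ∂P, Tendsto (fun n => S n ω) atTop (nhds (Sinf ω))) {n : ℕ} {A B : Set Ω}
    (hA : MeasurableSet[F n] A) (hB : MeasurableSet[F n] B) (hAB : A ⊆ B) :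
    ∫ ω in A, (S n ω - Sinf ω) ∂P ≤ ∫ ω in B, (S n ω - Sinf ω) ∂P := by
  have hint : Integrable (fun ω => S n ω - Sinf ω) P :=
    (hS.integrable n).sub (integrable_limit hS hnn hlim)
  have h := setIntegral_sub_limit_nonneg hS hnn hlim (hB.diff hA)
  rw [setIntegral_sdiff (F.le n _ hA) hint.integrableOn hAB] at h
  exact sub_nonneg.1 h

theorem setIntegral_sub_limit_le_add (hS : Martingale S F P) (hnn : ∀ᵐ ω ∂P, ∀ n, 0 ≤ S n ω)
    (hlim : ∀ᵐ ω ∂P, Tendsto (fun n => S n ω) atTop (nhds (Sinf ω))) {m n : ℕ} (hmn : m ≤ n)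
    {A B C : Set Ω} (hA : MeasurableSet[F n] A) (hB : MeasurableSet[F m] B)
    (hC : MeasurableSet[F n] C) (hAB : A ⊆ B ∪ C) :
    ∫ ω in A, (S n ω - Sinf ω) ∂P ≤
      ∫ ω in B, (S m ω - Sinf ω) ∂P + ∫ ω in C, (S n ω - Sinf ω) ∂P := by
  have hint : Integrable (fun ω => S n ω - Sinf ω) P :=
    (hS.integrable n).sub (integrable_limit hS hnn hlim)
  have hB' := F.mono hmn _ hB
  have h1 := setIntegral_sub_limit_mono hS hnn hlim hA (hB'.union hC) hAB
  rw [← union_sdiff_self, setIntegral_union disjoint_sdiff_right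
    (F.le n _ (hC.diff hB')) hint.integrableOn hint.integrableOn,
    setIntegral_sub_limit_eq hS hnn hlim hmn hB] at h1
  have h2 := setIntegral_sub_limit_mono hS hnn hlim (hC.diff hB') hC sdiff_subset
  linarith

/-- No mass is lost below a fixed level. -/
theorem tendsto_setIntegral_sub_limit_lt_level (hS : Martingale S F P)
    (hnn : ∀ᵐ ω ∂P, ∀ n, 0 ≤ S n ω)
    (hlim : ∀ᵐ ω ∂P, Tendsto (fun n => S n ω) atTop (nhds (Sinf ω))) (x' : ℝ) :
    Tendsto (fun n => ∫ ω in {ω | S n ω < x'}, (S n ω - Sinf ω) ∂P) atTop (nhds 0) := by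
  have hint := integrable_limit hS hnn hlim
  have hm : ∀ n, MeasurableSet {ω | S n ω < x'} := fun n =>
    F.le n _ (measurableSet_lt_level hS.1 x' n)
  simp_rw [← integral_indicator (hm _)]
  rw [← integral_zero Ω ℝ (μ := P)]
  refine tendsto_integral_of_dominated_convergence (fun ω => |x'| + |Sinf ω|)
    (fun n => (((hS.integrable n).sub hint).indicator (hm n)).aestronglyMeasurable)
    ((integrable_const _).add hint.abs) (fun n => ?_) ?_
  · filter_upwards [hnn] with ω h
    by_cases hω : S n ω < x'
    · rw [indicator_of_mem (by exact hω), Real.norm_eq_abs]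
      refine (abs_sub _ _).trans (add_le_add ?_ le_rfl)
      exact abs_le_abs_of_nonneg (h n) hω.le
    · rw [indicator_of_notMem (by exact hω), norm_zero]
      positivity
  · filter_upwards [hlim] with ω h
    refine squeeze_zero_norm (fun n => norm_indicator_le_norm_self _ _) ?_
    simpa using (h.sub_const (Sinf ω)).norm

/-- The mass lost at a random time is the limit of the mass lost before it occurs. -/
theorem tendsto_setIntegral_sub_limit_evalAt (hS : Martingale S F P)
    (hnn : ∀ᵐ ω ∂P, ∀ n, 0 ≤ S n ω)
    (hlim : ∀ᵐ ω ∂P, Tendsto (fun n => S n ω) atTop (nhds (Sinf ω))) {τ : Ω → ℕ∞}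
    (hτ : ∀ n : ℕ, MeasurableSet[F n] {ω | (n : ℕ∞) < τ ω}) :
    Tendsto (fun n : ℕ => ∫ ω in {ω | (n : ℕ∞) < τ ω}, (S n ω - Sinf ω) ∂P) atTop
      (nhds (∫ ω, S 0 ω ∂P - ∫ ω, evalAt S Sinf τ ω ∂P)) := by
  have hint := integrable_limit hS hnn hlim
  have hm : ∀ n : ℕ, MeasurableSet {ω | (n : ℕ∞) < τ ω} := fun n => F.le n _ (hτ n)
  have hT : ∀ n, Integrable (stoppedAt S τ n) P ∧
      ∫ ω, stoppedAt S τ n ω ∂P = ∫ ω, S 0 ω ∂P := by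
    intro n
    induction n with
    | zero =>
      have h0 : stoppedAt S τ 0 = S 0 := by
        ext ω
        simp [stoppedAt]
      simpa [h0] using hS.integrable 0
    | succ n ih =>
      have hd : Integrable (fun ω => S (n + 1) ω - S n ω) P :=
        (hS.integrable (n + 1)).sub (hS.integrable n)
      have hstep : stoppedAt S τ (n + 1) = fun ω => stoppedAt S τ n ω +
          {ω | (n : ℕ∞) < τ ω}.indicator (fun ω => S (n + 1) ω - S n ω) ω := by
        ext ω
        by_cases h : (n : ℕ∞) < τ ω
        · have h' : ((n + 1 : ℕ) : ℕ∞) ≤ τ ω := by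
            push_cast; exact Order.add_one_le_of_lt h
          rw [indicator_of_mem (by exact h), stoppedAt, stoppedAt, min_eq_left h',
            min_eq_left h.le, ENat.toNat_natCast, ENat.toNat_natCast]
          ring
        · have h1 : τ ω ≤ n := not_lt.1 h
          have h' : τ ω ≤ ((n + 1 : ℕ) : ℕ∞) := h1.trans (by exact_mod_cast n.le_succ)
          rw [indicator_of_notMem (by exact h), stoppedAt, stoppedAt, min_eq_right h',
            min_eq_right h1, add_zero]
      rw [hstep]
      refine ⟨ih.1.add (hd.indicator (hm n)), ?_⟩
      rw [integral_add ih.1 (hd.indicator (hm n)), ih.2, integral_indicator (hm n),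
        integral_sub (hS.integrable _).integrableOn (hS.integrable _).integrableOn,
        hS.setIntegral_eq n.le_succ (hτ n)]
      simp
  have hTlim : ∀ᵐ ω ∂P, Tendsto (fun n => stoppedAt S τ n ω) atTop
      (nhds (evalAt S Sinf τ ω)) := by
    filter_upwards [hlim] with ω h
    by_cases htop : τ ω = ⊤
    · simpa [stoppedAt, evalAt, htop] using h
    · obtain ⟨t, ht⟩ := ENat.ne_top_iff_exists.1 htop
      refine tendsto_const_nhds.congr' ?_
      filter_upwards [eventually_ge_atTop t] with n hn
      have : (t : ℕ∞) ≤ n := by exact_mod_cast hn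
      simp [stoppedAt, evalAt, ← ht, min_eq_right this]
  have hev : Integrable (evalAt S Sinf τ) P :=
    (integrable_and_integral_le_of_tendsto (fun n => (hT n).1)
      (fun n => hnn.mono fun ω h => h _) hTlim fun n => (hT n).2.le).1
  have hsub : Integrable (fun ω => evalAt S Sinf τ ω - Sinf ω) P := hev.sub hint
  have hrw : ∀ n : ℕ, ∫ ω in {ω | (n : ℕ∞) < τ ω}, (S n ω - Sinf ω) ∂P =
      (∫ ω, S 0 ω ∂P - ∫ ω, evalAt S Sinf τ ω ∂P) +
        ∫ ω, {ω | (n : ℕ∞) < τ ω}.indicator (fun ω => evalAt S Sinf τ ω - Sinf ω) ω ∂P := by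
    intro n
    rw [← (hT n).2, ← integral_sub (hT n).1 hev,
      ← integral_add (by exact (hT n).1.sub hev) (hsub.indicator (hm n)),
      ← integral_indicator (hm n)]
    refine integral_congr_ae (Eventually.of_forall fun ω => ?_)
    by_cases h : (n : ℕ∞) < τ ω
    · simp only [indicator_of_mem (show ω ∈ {ω | (n : ℕ∞) < τ ω} from h), stoppedAt,
        min_eq_left h.le, ENat.toNat_natCast]
      ring
    · have h1 : τ ω ≤ n := not_lt.1 h
      have h2 : τ ω ≠ ⊤ := ne_top_of_le_ne_top (ENat.natCast_ne_top n) h1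
      simp only [indicator_of_notMem (show ω ∉ {ω | (n : ℕ∞) < τ ω} from h), stoppedAt,
        min_eq_right h1, evalAt, if_neg h2]
      ring
  simp_rw [hrw]
  have h0 : Tendsto (fun n : ℕ => ∫ ω, {ω | (n : ℕ∞) < τ ω}.indicator
      (fun ω => evalAt S Sinf τ ω - Sinf ω) ω ∂P) atTop (nhds 0) := by
    rw [← integral_zero Ω ℝ (μ := P)]
    refine tendsto_integral_of_dominated_convergence
      (fun ω => ‖evalAt S Sinf τ ω - Sinf ω‖)
      (fun n => (hsub.indicator (hm n)).aestronglyMeasurable)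
      hsub.norm
      (fun n => Eventually.of_forall fun ω => norm_indicator_le_norm_self _ _)
      (Eventually.of_forall fun ω => ?_)
    by_cases htop : τ ω = ⊤
    · simp [evalAt, htop]
    · obtain ⟨t, ht⟩ := ENat.ne_top_iff_exists.1 htop
      refine tendsto_const_nhds.congr' ?_
      filter_upwards [eventually_ge_atTop t] with n hn
      rw [indicator_of_notMem]
      rw [mem_ofPred_eq, ← ht, not_lt]
      exact_mod_cast hn
  simpa using h0.const_add (∫ ω, S 0 ω ∂P - ∫ ω, evalAt S Sinf τ ω ∂P)

/-- If mass is never lost along monotone paths started above `x'`, then it is never lost along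
monotone paths. -/
theorem tendsto_setIntegral_sub_limit_monoEvent (hS : Martingale S F P)
    (hnn : ∀ᵐ ω ∂P, ∀ n, 0 ≤ S n ω)
    (hlim : ∀ᵐ ω ∂P, Tendsto (fun n => S n ω) atTop (nhds (Sinf ω))) {x' : ℝ}
    (h : ∀ k, Tendsto
      (fun n => ∫ ω in {ω | x' ≤ S k ω} ∩ monoEvent S k n, (S n ω - Sinf ω) ∂P) atTop (nhds 0)) (k : ℕ) :
    Tendsto (fun n => ∫ ω in monoEvent S k n, (S n ω - Sinf ω) ∂P) atTop (nhds 0) := by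
  refine tendsto_order.2 ⟨fun a ha => Eventually.of_forall fun n => ha.trans_le
    (setIntegral_sub_limit_nonneg hS hnn hlim (measurableSet_monoEvent hS.1 k n)), fun ε hε => ?_⟩
  have hlevel := tendsto_setIntegral_sub_limit_lt_level hS hnn hlim x'
  obtain ⟨J, hJ, hkJ⟩ :=
    ((hlevel.eventually_lt_const (half_pos hε)).and (eventually_ge_atTop k)).exists
  filter_upwards [(h J).eventually_lt_const (half_pos hε), eventually_ge_atTop J] with n hn hJn
  have := setIntegral_sub_limit_le_add hS hnn hlim hJn (measurableSet_monoEvent hS.1 k n)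
    (measurableSet_lt_level hS.1 x' J)
    ((F.mono hJn _ (measurableSet_level_le hS.1 x' J)).inter (measurableSet_monoEvent hS.1 J n))
    (fun ω hω => (lt_or_ge (S J ω) x').imp id fun h' =>
      ⟨h', monoEvent_subset_of_le hkJ hω⟩)
  linarith

/-- If mass is never lost along monotone paths, then it is never lost before a drawdown. -/
theorem tendsto_setIntegral_sub_limit_drawdown (hS : Martingale S F P)
    (hnn : ∀ᵐ ω ∂P, ∀ n, 0 ≤ S n ω)
    (hlim : ∀ᵐ ω ∂P, Tendsto (fun n => S n ω) atTop (nhds (Sinf ω)))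
    (h : ∀ k, Tendsto (fun n => ∫ ω in monoEvent S k n, (S n ω - Sinf ω) ∂P)
      atTop (nhds 0)) (k : ℕ) :
    Tendsto (fun n : ℕ => ∫ ω in {ω | (n : ℕ∞) < drawdown S k ω}, (S n ω - Sinf ω) ∂P)
      atTop (nhds 0) := by
  induction k with
  | zero => simp [drawdown]
  | succ k ih =>
    refine tendsto_order.2 ⟨fun a ha => Eventually.of_forall fun n => ha.trans_le
      (setIntegral_sub_limit_nonneg hS hnn hlim (measurableSet_lt_drawdown hS.1 (k + 1) n)),
      fun ε hε => ?_⟩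
    obtain ⟨J, hJ⟩ := (ih.eventually_lt_const (half_pos hε)).exists
    filter_upwards [(h J).eventually_lt_const (half_pos hε), eventually_ge_atTop J] with n hn hJn
    have := setIntegral_sub_limit_le_add hS hnn hlim hJn
      (measurableSet_lt_drawdown hS.1 (k + 1) n) (measurableSet_lt_drawdown hS.1 k J)
      (measurableSet_monoEvent hS.1 J n) lt_drawdown_succ_subset
    linarith

/-- A nonnegative martingale is a bubble if and only if it loses mass along monotone paths started
above a given level `x'`. -/
theorem isBubble_iff_exists_tendsto (hS : Martingale S F P)
    (hnn : ∀ᵐ ω ∂P, ∀ n, 0 ≤ S n ω)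
    (hlim : ∀ᵐ ω ∂P, Tendsto (fun n => S n ω) atTop (nhds (Sinf ω))) (x' : ℝ) :
    IsBubble S Sinf P ↔ ∃ k : ℕ, ∃ L > (0 : ℝ), Tendsto
      (fun n => ∫ ω in {ω | x' ≤ S k ω} ∩ monoEvent S k n, (S n ω - Sinf ω) ∂P)
      atTop (nhds L) := by
  have hmeas : ∀ k n, k ≤ n → MeasurableSet[F n] ({ω | x' ≤ S k ω} ∩ monoEvent S k n) :=
    fun k n hkn => (F.mono hkn _ (measurableSet_level_le hS.1 x' k)).inter
      (measurableSet_monoEvent hS.1 k n)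
  have heval : ∀ k, _ := fun k => tendsto_setIntegral_sub_limit_evalAt hS hnn hlim
    (measurableSet_lt_drawdown hS.1 k)
  constructor
  · rintro ⟨k, hk⟩
    by_contra! hcon
    have hzero : ∀ k, Tendsto
        (fun n => ∫ ω in {ω | x' ≤ S k ω} ∩ monoEvent S k n, (S n ω - Sinf ω) ∂P)
        atTop (nhds 0) := by
      intro k
      set g := fun n => ∫ ω in {ω | x' ≤ S k ω} ∩ monoEvent S k n, (S n ω - Sinf ω) ∂P with hg
      have hanti : Antitone fun n => g (n + k) := by
        refine antitone_nat_of_succ_le fun n => ?_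
        rw [hg]
        dsimp only
        rw [← setIntegral_sub_limit_eq hS hnn hlim (show n + k ≤ n + 1 + k by omega)
          (hmeas k (n + k) (by omega))]
        exact setIntegral_sub_limit_mono hS hnn hlim (hmeas k _ (by omega))
          (F.mono (by omega) _ (hmeas k (n + k) (by omega)))
          (inter_subset_inter_right _ (monoEvent_antitone k (by omega)))
      have hpos : ∀ n, 0 ≤ g (n + k) := fun n =>
        setIntegral_sub_limit_nonneg hS hnn hlim (hmeas k _ (by omega))
      have htend := (tendsto_add_atTop_iff_nat k).1
        (tendsto_atTop_ciInf hanti ⟨0, by rintro _ ⟨n, rfl⟩; exact hpos n⟩)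
      have hL : (⨅ n, g (n + k)) = 0 := by
        refine le_antisymm (not_lt.1 fun hlt => hcon k _ hlt htend) (le_ciInf hpos)
      rwa [hL] at htend
    have := tendsto_nhds_unique (heval (k + 1)) (tendsto_setIntegral_sub_limit_drawdown hS hnn hlim
      (tendsto_setIntegral_sub_limit_monoEvent hS hnn hlim hzero) (k + 1))
    linarith
  · rintro ⟨k, L, hL, hk⟩
    refine ⟨k, sub_pos.1 (hL.trans_le (le_of_tendsto_of_tendsto hk (heval (k + 1)) ?_))⟩
    filter_upwards [eventually_ge_atTop k] with n hn
    exact setIntegral_sub_limit_mono hS hnn hlim (hmeas k n hn)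
      (measurableSet_lt_drawdown hS.1 (k + 1) n)
      (inter_subset_right.trans (monoEvent_subset_lt_drawdown k n))

end LossOfMass

namespace MarkovMartingale

open ProbabilityTheory

variable {Ω : Type*} [MeasurableSpace Ω]

/-- The Markov property for the joint law of two consecutive states on an event of the past. -/
theorem map_pair_eq_compProd (M : MarkovMartingale Ω) {x : ℝ} (hx : 0 < x) (n : ℕ) {E : Set Ω}
    (hE : MeasurableSet[M.F n] E) :
    ((M.P x).restrict E).map (fun ω => (M.S n ω, M.S (n + 1) ω)) =
      ((M.P x).restrict E).map (M.S n) ⊗ₘ M.K := by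
  have := M.prob x hx
  have := M.markov
  have hSn : ∀ m, Measurable (M.S m) := fun m =>
    ((M.mart x hx).1 m).measurable.mono (M.F.le m) le_rfl
  refine Measure.ext_prod fun {B C} hB hC => ?_
  have hBE : MeasurableSet[M.F n] (M.S n ⁻¹' B ∩ E) :=
    (((M.mart x hx).1 n).measurable hB).inter hE
  have hCm : MeasurableSet (M.S (n + 1) ⁻¹' C) := hSn _ hC
  have hK : Measurable fun ω => (M.K (M.S n ω)).real C :=
    ((M.K.measurable_coe hC).comp (hSn n)).ennreal_toReal
  have hKint : Integrable (fun ω => (M.K (M.S n ω)).real C) (M.P x) :=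
    Integrable.of_bound hK.aestronglyMeasurable 1
      (Eventually.of_forall fun ω => by
        rw [Real.norm_of_nonneg measureReal_nonneg]; exact measureReal_le_one)
  have hstep := M.step x hx n (C.indicator fun _ => 1) (measurable_const.indicator hC)
    ⟨1, fun y => by by_cases h : y ∈ C <;> simp [h]⟩
  have hind : (fun ω => C.indicator (fun _ => (1 : ℝ)) (M.S (n + 1) ω)) =
      (M.S (n + 1) ⁻¹' C).indicator fun _ => 1 := rfl
  have hreal : (M.P x).real ((M.S n ⁻¹' B ∩ E) ∩ M.S (n + 1) ⁻¹' C) =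
      ∫ ω in M.S n ⁻¹' B ∩ E, (M.K (M.S n ω)).real C ∂M.P x := by
    rw [hind] at hstep
    have h1 := setIntegral_condExp (M.F.le n)
      ((integrable_const (1 : ℝ)).indicator hCm : Integrable _ (M.P x)) hBE
    rw [setIntegral_congr_ae (M.F.le n _ hBE) (hstep.mono fun ω h _ => h)] at h1
    simp only [integral_indicator_const _ hC] at h1
    rw [setIntegral_indicator hCm] at h1
    simpa using h1.symm
  rw [Measure.map_apply ((hSn n).prodMk (hSn (n + 1))) (hB.prod hC),
    Measure.compProd_apply_prod hB hC, setLIntegral_map hB (M.K.measurable_coe hC) (hSn n),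
    Measure.restrict_restrict (hSn n hB), Measure.restrict_apply
      (((hSn n).prodMk (hSn (n + 1))) (hB.prod hC))]
  have hset : (fun ω => (M.S n ω, M.S (n + 1) ω)) ⁻¹' B ×ˢ C ∩ E =
      (M.S n ⁻¹' B ∩ E) ∩ M.S (n + 1) ⁻¹' C := by
    ext ω
    simp only [mem_inter_iff, mem_preimage, mem_prod]
    tauto
  rw [hset, ← ofReal_measureReal, hreal, ofReal_integral_eq_lintegral_ofReal hKint.integrableOn
    (Eventually.of_forall fun ω => measureReal_nonneg)]
  exact lintegral_congr fun ω => ofReal_measureReal (measure_ne_top _ _)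

/-- The probability of a downward move after time `n` on an event where `a ≥ c`. -/
theorem mul_measureReal_le_drop (M : MarkovMartingale Ω) {x : ℝ} (hx : 0 < x) (n : ℕ) {E : Set Ω}
    (hE : MeasurableSet[M.F n] E) {c : ℝ} (hc : ∀ ω ∈ E, c ≤ M.a (M.S n ω)) :
    c * (M.P x).real E ≤ (M.P x).real (E ∩ {ω | M.S (n + 1) ω < M.S n ω}) := by
  have := M.prob x hx
  have := M.markov
  have hSn : ∀ m, Measurable (M.S m) := fun m =>
    ((M.mart x hx).1 m).measurable.mono (M.F.le m) le_rfl
  have hEm := M.F.le n _ hE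
  have hD : MeasurableSet {p : ℝ × ℝ | p.2 < p.1} := measurableSet_lt measurable_snd measurable_fst
  have key : ENNReal.ofReal c * M.P x E ≤ M.P x (E ∩ {ω | M.S (n + 1) ω < M.S n ω}) := by
    calc ENNReal.ofReal c * M.P x E = ∫⁻ _ in E, ENNReal.ofReal c ∂M.P x := by
          rw [setLIntegral_const]
      _ ≤ ∫⁻ ω in E, M.K (M.S n ω) (Prod.mk (M.S n ω) ⁻¹' {p : ℝ × ℝ | p.2 < p.1}) ∂M.P x := by
          refine setLIntegral_mono' hEm fun ω hω => ?_
          refine (ENNReal.ofReal_le_of_le_toReal (hc ω hω)).trans (measure_mono fun y hy => ?_)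
          exact hy.2
      _ = (((M.P x).restrict E).map (M.S n) ⊗ₘ M.K) {p : ℝ × ℝ | p.2 < p.1} := by
          rw [Measure.compProd_apply hD,
            lintegral_map (Kernel.measurable_kernel_prodMk_left hD) (hSn n)]
      _ = M.P x (E ∩ {ω | M.S (n + 1) ω < M.S n ω}) := by
          rw [← M.map_pair_eq_compProd hx n hE,
            Measure.map_apply ((hSn n).prodMk (hSn (n + 1))) hD, Measure.restrict_apply
            (((hSn n).prodMk (hSn (n + 1))) hD), inter_comm]
          rfl
  rcases le_or_gt c 0 with h0 | h0
  · exact (mul_nonpos_of_nonpos_of_nonneg h0 measureReal_nonneg).trans measureReal_nonneg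
  · have := ENNReal.toReal_mono (measure_ne_top _ _) key
    rwa [ENNReal.toReal_mul, ENNReal.toReal_ofReal h0.le] at this

/-- Almost surely, the process does not stay nondecreasing forever within `[x', y]`. -/
theorem measureReal_monoEvent_le_level_eq_zero (M : MarkovMartingale Ω) {xa x' : ℝ}
    (ha : M.ALowerBound xa) (hx' : xa ≤ x') {x : ℝ} (hx : 0 < x) (k : ℕ) (y : ℝ) :
    (M.P x).real {ω | x' ≤ M.S k ω ∧ ∀ n, ω ∈ monoEvent M.S k n ∧ M.S n ω ≤ y} = 0 := by
  have := M.prob x hx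
  have hS := (M.mart x hx).1
  obtain ⟨c, hc, hca⟩ := ha.2 (max y xa + 1) (by have := le_max_right y xa; linarith)
  have hc1 : 0 ≤ 1 - min c 1 := sub_nonneg.2 (min_le_right _ _)
  set E : ℕ → Set Ω := fun n =>
    ({ω | x' ≤ M.S k ω} ∩ monoEvent M.S k (k + n)) ∩ {ω | M.S (k + n) ω ≤ y}
  have hE : ∀ n, MeasurableSet[M.F (k + n)] (E n) := fun n =>
    ((M.F.mono (Nat.le_add_right k n) _ (measurableSet_level_le hS x' k)).inter
      (measurableSet_monoEvent hS k (k + n))).inter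
      (hS.adapted (k + n) measurableSet_Iic)
  have hlow : ∀ n, ∀ ω ∈ E n, x' ≤ M.S (k + n) ω := by
    rintro n ω ⟨⟨h1, h2⟩, -⟩
    have : ∀ m ≤ n, x' ≤ M.S (k + m) ω := by
      intro m
      induction m with
      | zero => exact fun _ => h1
      | succ m ih => exact fun hm => (ih (by omega)).trans (h2 (k + m) (by omega) (by omega))
    exact this n le_rfl
  have hstep : ∀ n, (M.P x).real (E (n + 1)) ≤ (1 - min c 1) * (M.P x).real (E n) := by
    intro n
    have h1 := M.mul_measureReal_le_drop hx (k + n) (hE n) (c := c) fun ω hω =>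
      hca _ ⟨hx'.trans (hlow n ω hω), by
        have h3 : M.S (k + n) ω ≤ y := hω.2
        have := le_max_left y xa
        linarith⟩
    have hDm : MeasurableSet {ω | M.S (k + n + 1) ω < M.S (k + n) ω} :=
      measurableSet_lt ((hS.adapted _).mono (M.F.le _) le_rfl)
        ((hS.adapted _).mono (M.F.le _) le_rfl)
    have h2 : (M.P x).real (E (n + 1)) ≤
        (M.P x).real (E n \ {ω | M.S (k + n + 1) ω < M.S (k + n) ω}) := by
      refine measureReal_mono fun ω hω => ?_
      have h4 : M.S (k + n) ω ≤ M.S (k + n + 1) ω := hω.1.2 (k + n) (by omega) (by omega)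
      exact ⟨⟨⟨hω.1.1, monoEvent_antitone k (by omega) hω.1.2⟩, h4.trans hω.2⟩, not_lt.2 h4⟩
    have h3 := measureReal_inter_add_sdiff (μ := M.P x) (s := E n) hDm
    have h4 : min c 1 * (M.P x).real (E n) ≤ c * (M.P x).real (E n) :=
      mul_le_mul_of_nonneg_right (min_le_left _ _) measureReal_nonneg
    linarith
  have hgeom : ∀ n, (M.P x).real (E n) ≤ (1 - min c 1) ^ n := by
    intro n
    induction n with
    | zero => simp
    | succ n ih =>
      rw [pow_succ']
      exact (hstep n).trans (mul_le_mul_of_nonneg_left ih hc1)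
  refine le_antisymm (ge_of_tendsto' (tendsto_pow_atTop_nhds_zero_of_lt_one hc1
    (by have : 0 < min c 1 := lt_min hc one_pos
        linarith)) fun n => ?_) measureReal_nonneg
  refine (measureReal_mono (s₂ := E n) fun ω hω => ?_).trans (hgeom n)
  exact ⟨⟨hω.1, (hω.2 _).1⟩, (hω.2 _).2⟩

/-- Almost surely, the process started above `x'` does not stay nondecreasing forever. -/
theorem ae_exists_notMem_monoEvent (M : MarkovMartingale Ω) {xa x' : ℝ}
    (ha : M.ALowerBound xa) (hx' : xa ≤ x') {x : ℝ} (hx : 0 < x) (k : ℕ) :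
    ∀ᵐ ω ∂M.P x, ∃ n, ω ∉ {ω | x' ≤ M.S k ω} ∩ monoEvent M.S k n := by
  have := M.prob x hx
  have h : ∀ᵐ ω ∂M.P x, ∀ N : ℕ,
      ¬ (x' ≤ M.S k ω ∧ ∀ n, ω ∈ monoEvent M.S k n ∧ M.S n ω ≤ N) :=
    ae_all_iff.2 fun N => measure_eq_zero_iff_ae_notMem.1
      ((measureReal_eq_zero_iff).1 (M.measureReal_monoEvent_le_level_eq_zero ha hx' hx k N))
  filter_upwards [h, M.conv x hx] with ω h hconv
  by_contra! hcon
  obtain ⟨C, hC⟩ := hconv.bddAbove_range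
  obtain ⟨N, hN⟩ := exists_nat_ge C
  exact h N ⟨(hcon 0).1, fun n => ⟨(hcon n).2, (hC ⟨n, rfl⟩).trans hN⟩⟩

end MarkovMartingale

/-- Under the lower bound assumption on `a`, for every `x' ≥ x_a` and every
starting point `x > 0`: the limit `lim_n E_x[S_∞ 1_{{x' ≤ S_k ≤ ⋯ ≤ S_n}}] = 0` for each `k`,
and `S` is a bubble under `P_x` iff `lim_n E_x[S_n 1_{{x' ≤ S_k ≤ ⋯ ≤ S_n}}] > 0` for some `k`. -/
theorem MarkovMartingale.bubble_char_of_aLowerBound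
    {Ω : Type*} [MeasurableSpace Ω] (M : MarkovMartingale Ω)
    {xa : ℝ} (ha : M.ALowerBound xa) :
    ∀ x' : ℝ, xa ≤ x' → ∀ x : ℝ, 0 < x →
      (∀ k : ℕ,
        Tendsto
          (fun n => ∫ ω, M.Sinf ω *
            ({ω' | x' ≤ M.S k ω'} ∩ monoEvent M.S k n).indicator (fun _ => (1 : ℝ)) ω ∂M.P x)
          atTop (nhds 0)) ∧
      (M.Bubble x ↔
        ∃ k : ℕ, ∃ L > (0 : ℝ),
          Tendsto
            (fun n => ∫ ω, M.S n ω *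
              ({ω' | x' ≤ M.S k ω'} ∩ monoEvent M.S k n).indicator (fun _ => (1 : ℝ)) ω ∂M.P x)
            atTop (nhds L)) := by
  intro x' hx' x hx
  have := M.prob x hx
  have hS := M.mart x hx
  have hnn : ∀ᵐ ω ∂M.P x, ∀ n, 0 ≤ M.S n ω := (M.pos x hx).mono fun ω h n => (h n).le
  have hlim := M.conv x hx
  have hint := integrable_limit hS hnn hlim
  have hm : ∀ k n, MeasurableSet ({ω | x' ≤ M.S k ω} ∩ monoEvent M.S k n) := fun k n =>
    (M.F.le _ _ (measurableSet_level_le hS.1 x' k)).inter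
      (M.F.le _ _ (measurableSet_monoEvent hS.1 k n))
  have hind : ∀ (f : Ω → ℝ) (A : Set Ω),
      (fun ω => f ω * A.indicator (fun _ => (1 : ℝ)) ω) = A.indicator f := by
    intro f A
    ext ω
    by_cases h : ω ∈ A <;> simp [h]
  simp_rw [hind]
  have hzero : ∀ k, Tendsto (fun n => ∫ ω, ({ω | x' ≤ M.S k ω} ∩ monoEvent M.S k n).indicator
      M.Sinf ω ∂M.P x) atTop (nhds 0) := by
    intro k
    rw [← integral_zero Ω ℝ (μ := M.P x)]
    refine tendsto_integral_of_dominated_convergence (fun ω => ‖M.Sinf ω‖)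
      (fun n => (hint.indicator (hm k n)).aestronglyMeasurable) hint.norm
      (fun n => Eventually.of_forall fun ω => norm_indicator_le_norm_self _ _) ?_
    filter_upwards [M.ae_exists_notMem_monoEvent ha hx' hx k] with ω ⟨N, hN⟩
    refine tendsto_const_nhds.congr' ?_
    filter_upwards [eventually_ge_atTop N] with n hn
    rw [indicator_of_notMem]
    exact fun h => hN ⟨h.1, monoEvent_antitone k hn h.2⟩
  refine ⟨hzero, (isBubble_iff_exists_tendsto hS hnn hlim x').trans ?_⟩
  refine exists_congr fun k => exists_congr fun L => and_congr_right fun _ => ?_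
  have hsub : ∀ n, ∫ ω in {ω | x' ≤ M.S k ω} ∩ monoEvent M.S k n, (M.S n ω - M.Sinf ω) ∂M.P x =
      ∫ ω, ({ω | x' ≤ M.S k ω} ∩ monoEvent M.S k n).indicator (M.S n) ω ∂M.P x -
        ∫ ω, ({ω | x' ≤ M.S k ω} ∩ monoEvent M.S k n).indicator M.Sinf ω ∂M.P x := by
    intro n
    rw [integral_indicator (hm k n), integral_indicator (hm k n),
      integral_sub (hS.integrable n).integrableOn hint.integrableOn]
  simp_rw [hsub]
  constructor
  · intro h
    simpa using h.add (hzero k)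
  · intro h
    simpa using h.sub (hzero k)
end

section
/- Let S be a positive Markov martingale with kernel K satisfying the drawdown-probability lower bound assumption (for some x_a, inf_{x∈[x_a,y]} a(x) > 0 for all y > x_a, where a(x) = K(x,[0,x))). Suppose there exist ε > 0 and x_b > 0 such that b_ε(x) := (1/x)∫_{[0,x(1+ε))} y K(x,dy) is nonincreasing on [x_b,∞) and ∫_{log x_b}^∞ b_ε(e^u) du < ∞. Then S is a bubble under P_x for every x for which S is not P_x-a.s. bounded. -/
open MeasureTheory Filter Set

section Paths

variable {Ω : Type*} {S : ℕ → Ω → ℝ}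

theorem natCast_le_drawdown (S : ℕ → Ω → ℝ) (k : ℕ) (ω : Ω) : (k : ℕ∞) ≤ drawdown S k ω := by
  induction k with
  | zero => simp
  | succ k ih =>
    refine le_sInf fun j hj => ?_
    rw [Nat.cast_succ]
    exact Order.add_one_le_of_lt (ih.trans_lt hj.1)

theorem isStoppingTime_drawdown [m0 : MeasurableSpace Ω] {F : Filtration ℕ m0}
    (hS : StronglyAdapted F S) (k : ℕ) : IsStoppingTime F (drawdown S k) := by
  induction k with
  | zero => exact isStoppingTime_const F 0
  | succ k ih =>
    intro i
    have hset : {ω | drawdown S (k + 1) ω ≤ (i : ℕ∞)} =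
        ⋃ n ∈ Finset.Iic i, {ω | drawdown S k ω < (n : ℕ∞)} ∩ {ω | S n ω < S (n - 1) ω} := by
      ext ω
      simp only [mem_ofPred_eq, mem_iUnion, mem_inter_iff, Finset.mem_Iic, exists_prop]
      constructor
      · intro h
        have hne : {j : ℕ∞ | drawdown S k ω < j ∧
            ∃ n : ℕ, j = (n : ℕ∞) ∧ S n ω < S (n - 1) ω}.Nonempty := by
          by_contra hempty
          rw [not_nonempty_iff_eq_empty] at hempty
          simp [drawdown, hempty] at h
        obtain ⟨hlt, n, hn, hdrop⟩ := csInf_mem hne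
        refine ⟨n, ?_, ?_, hdrop⟩
        · exact_mod_cast hn.symm.trans_le h
        · exact hlt.trans_eq hn
      · rintro ⟨n, hni, hlt, hdrop⟩
        have hle : drawdown S (k + 1) ω ≤ n := sInf_le ⟨hlt, n, rfl, hdrop⟩
        exact hle.trans (by exact_mod_cast hni)
    change MeasurableSet[F i] {ω | drawdown S (k + 1) ω ≤ (i : ℕ∞)}
    rw [hset]
    refine Finset.measurableSet_biUnion _ fun n hn => ?_
    rw [Finset.mem_Iic] at hn
    have hdrop : MeasurableSet[F i] {ω | S n ω < S (n - 1) ω} :=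
      measurableSet_lt ((hS n).mono (F.mono hn)).measurable
        ((hS (n - 1)).mono (F.mono ((Nat.sub_le n 1).trans hn))).measurable
    exact ((F.mono hn) _ (ih.measurableSet_lt n)).inter hdrop

theorem stoppedAt_eq_stoppedProcess (S : ℕ → Ω → ℝ) (τ : Ω → ℕ∞) :
    stoppedAt S τ = stoppedProcess S τ := by
  funext n ω
  unfold stoppedAt stoppedProcess
  congr 1
  have h : min (n : ℕ∞) (τ ω) ≠ ⊤ := ne_top_of_le_ne_top (ENat.natCast_ne_top n) (min_le_left _ _)
  obtain ⟨t, ht⟩ := ENat.ne_top_iff_exists.1 h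
  exact (congrArg ENat.toNat ht.symm).trans (congrArg WithTop.untopA ht)

theorem tendsto_stoppedAt {Sinf : Ω → ℝ} {ω : Ω} (τ : Ω → ℕ∞)
    (h : Tendsto (fun n => S n ω) atTop (nhds (Sinf ω))) :
    Tendsto (fun n => stoppedAt S τ n ω) atTop (nhds (evalAt S Sinf τ ω)) := by
  by_cases hτ : τ ω = ⊤
  · simpa [stoppedAt, evalAt, hτ] using h
  · obtain ⟨t, ht⟩ := ENat.ne_top_iff_exists.1 hτ
    rw [evalAt, if_neg hτ]
    refine tendsto_const_nhds.congr' ?_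
    filter_upwards [eventually_ge_atTop t] with n hn
    rw [stoppedAt, min_eq_right (by rw [← ht]; exact_mod_cast hn)]

/-- The event that `S` is at least `y` at time `n` and then grows by a factor of at least `q` in
each of the following `m` steps. -/
def growthEvent (S : ℕ → Ω → ℝ) (y q : ℝ) (n m : ℕ) : Set Ω :=
  {ω | y ≤ S n ω ∧ ∀ j < m, q * S (n + j) ω ≤ S (n + j + 1) ω}

variable {y q : ℝ} {n : ℕ}

theorem growthEvent_zero : growthEvent S y q n 0 = {ω | y ≤ S n ω} := by
  simp [growthEvent]

theorem growthEvent_succ (m : ℕ) : growthEvent S y q n (m + 1) =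
    growthEvent S y q n m ∩ {ω | q * S (n + m) ω ≤ S (n + m + 1) ω} := by
  ext ω
  simp only [growthEvent, mem_ofPred_eq, mem_inter_iff, Nat.forall_lt_succ_right, and_assoc]

theorem growthEvent_subset_of_le {m k : ℕ} (h : m ≤ k) :
    growthEvent S y q n k ⊆ growthEvent S y q n m :=
  fun _ hω => ⟨hω.1, fun j hj => hω.2 j (hj.trans_le h)⟩

theorem mul_pow_le_of_mem_growthEvent (hq : 0 ≤ q) {m : ℕ} {ω : Ω}
    (hω : ω ∈ growthEvent S y q n m) : y * q ^ m ≤ S (n + m) ω := by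
  induction m with
  | zero => simpa using hω.1
  | succ m ih =>
    have h1 := ih (growthEvent_subset_of_le m.le_succ hω)
    calc y * q ^ (m + 1) = q * (y * q ^ m) := by ring
      _ ≤ q * S (n + m) ω := by gcongr
      _ ≤ S (n + (m + 1)) ω := hω.2 m m.lt_succ_self

theorem measurableSet_growthEvent [m0 : MeasurableSpace Ω] {F : Filtration ℕ m0}
    (hS : StronglyAdapted F S) (m : ℕ) : MeasurableSet[F (n + m)] (growthEvent S y q n m) := by
  induction m with
  | zero =>
    rw [growthEvent_zero]
    exact measurableSet_le measurable_const (hS n).measurable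
  | succ m ih =>
    rw [growthEvent_succ]
    refine (F.mono (Nat.le_succ _) _ ih).inter ?_
    exact measurableSet_le
      (((hS (n + m)).mono (F.mono (Nat.le_succ _))).measurable.const_mul q)
      (hS (n + m + 1)).measurable

theorem le_drawdown_of_mem_growthEvent (hy : 0 ≤ y) (hq : 1 ≤ q) {m : ℕ} {ω : Ω}
    (hω : ω ∈ growthEvent S y q n m) : ((n + m : ℕ) : ℕ∞) ≤ drawdown S (n + 1) ω := by
  refine le_sInf ?_
  rintro j ⟨hj, p, rfl, hp⟩
  have hnp : n < p := by exact_mod_cast (natCast_le_drawdown S n ω).trans_lt hj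
  by_contra! hlt
  have hpm : p < n + m := by exact_mod_cast hlt
  obtain ⟨i, rfl⟩ : ∃ i, p = n + i + 1 := ⟨p - n - 1, by omega⟩
  have hstep := hω.2 i (by omega)
  have hpos : 0 ≤ S (n + i) ω :=
    (by positivity : 0 ≤ y * q ^ i).trans (mul_pow_le_of_mem_growthEvent (by linarith)
      (growthEvent_subset_of_le (by omega) hω))
  rw [Nat.add_sub_cancel] at hp
  nlinarith

theorem stoppedAt_drawdown_of_mem_growthEvent (hy : 0 ≤ y) (hq : 1 ≤ q) {m : ℕ} {ω : Ω}
    (hω : ω ∈ growthEvent S y q n m) :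
    stoppedAt S (drawdown S (n + 1)) (n + m) ω = S (n + m) ω := by
  rw [stoppedAt, min_eq_left (le_drawdown_of_mem_growthEvent hy hq hω), ENat.toNat_natCast]

theorem eventually_notMem_growthEvent (hy : 0 < y) (hq : 1 < q) {ω : Ω} {l : ℝ}
    (h : Tendsto (fun n => S n ω) atTop (nhds l)) :
    ∀ᶠ m in atTop, ω ∉ growthEvent S y q n m := by
  have hgrow : Tendsto (fun m : ℕ => y * q ^ m) atTop atTop :=
    (tendsto_pow_atTop_atTop_of_one_lt hq).const_mul_atTop hy
  have hS : Tendsto (fun m => S (n + m) ω) atTop (nhds l) := by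
    simpa only [add_comm n] using! h.comp (tendsto_add_atTop_nat n)
  filter_upwards [hgrow.eventually_gt_atTop (l + 1), hS.eventually_lt_const (lt_add_one l)]
    with m h1 h2 hω
  linarith [mul_pow_le_of_mem_growthEvent (by linarith) hω]

end Paths

section MassLoss

variable {Ω : Type*} [m0 : MeasurableSpace Ω] {P : Measure Ω} [IsFiniteMeasure P]
  {F : Filtration ℕ m0} {S : ℕ → Ω → ℝ}

theorem MeasureTheory.Martingale.stoppedAt (hS : Martingale S F P) {τ : Ω → ℕ∞}
    (hτ : IsStoppingTime F τ) : Martingale (stoppedAt S τ) F P := by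
  rw [stoppedAt_eq_stoppedProcess, martingale_iff]
  refine ⟨?_, hS.submartingale.stoppedProcess hτ⟩
  have := (hS.neg.submartingale.stoppedProcess hτ).neg
  convert! this using 1
  funext i ω
  simp [stoppedProcess]

/-- Mass which the martingale carries on events avoiding `τ` and vanishing in the limit is lost
at time `τ`. -/
theorem integral_evalAt_lt (hS : Martingale S F P) (hpos : ∀ᵐ ω ∂P, ∀ n, 0 < S n ω)
    (h0 : 0 < ∫ ω, S 0 ω ∂P) {Sinf : Ω → ℝ}
    (hconv : ∀ᵐ ω ∂P, Tendsto (fun n => S n ω) atTop (nhds (Sinf ω))) {τ : Ω → ℕ∞}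
    (hτ : IsStoppingTime F τ) {n : ℕ} {U : ℕ → Set Ω} (hU : ∀ m, MeasurableSet (U m))
    (hvanish : ∀ᵐ ω ∂P, ∀ᶠ m in atTop, ω ∉ U m)
    (hUτ : ∀ m, ∀ ω ∈ U m, stoppedAt S τ (n + m) ω = S (n + m) ω) {c : ℝ} (hc : 0 < c)
    (hmass : ∀ m, c ≤ ∫ ω in U m, S (n + m) ω ∂P) :
    ∫ ω, evalAt S Sinf τ ω ∂P < ∫ ω, S 0 ω ∂P := by
  by_cases hint : Integrable (evalAt S Sinf τ) P
  swap
  · rwa [integral_undef hint]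
  have hT := hS.stoppedAt hτ
  have hTpos : ∀ᵐ ω ∂P, ∀ n, 0 ≤ stoppedAt S τ n ω := by
    filter_upwards [hpos] with ω hω n using (hω _).le
  have hlim : ∀ᵐ ω ∂P, Tendsto (fun m => (U m)ᶜ.indicator (stoppedAt S τ (n + m)) ω) atTop
      (nhds (evalAt S Sinf τ ω)) := by
    filter_upwards [hconv, hvanish] with ω h1 h2
    have h3 : Tendsto (fun m => stoppedAt S τ (n + m) ω) atTop (nhds (evalAt S Sinf τ ω)) := by
      simpa only [add_comm n] using! (tendsto_stoppedAt τ h1).comp (tendsto_add_atTop_nat n)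
    refine h3.congr' ?_
    filter_upwards [h2] with m hm
    rw [indicator_of_mem (mem_compl hm)]
  have hnonneg : 0 ≤ᵐ[P] evalAt S Sinf τ := by
    filter_upwards [hlim, hTpos] with ω h1 h2
    exact ge_of_tendsto' h1 fun m => indicator_apply_nonneg fun _ => h2 _
  have hbound : ∀ m, ∫ ω, (U m)ᶜ.indicator (stoppedAt S τ (n + m)) ω ∂P ≤
      ∫ ω, S 0 ω ∂P - c := by
    intro m
    have h1 : ∫ ω, stoppedAt S τ (n + m) ω ∂P = ∫ ω, S 0 ω ∂P := by
      have := hT.setIntegral_eq (Nat.zero_le (n + m)) MeasurableSet.univ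
      simp only [setIntegral_univ] at this
      rw [← this]
      simp [_root_.stoppedAt]
    have h2 : ∫ ω in U m, stoppedAt S τ (n + m) ω ∂P = ∫ ω in U m, S (n + m) ω ∂P :=
      setIntegral_congr_fun (hU m) (hUτ m)
    rw [integral_indicator (hU m).compl]
    have h3 := integral_add_compl (hU m) (hT.integrable (n + m))
    linarith [hmass m]
  have hint_ind : ∀ m, Integrable ((U m)ᶜ.indicator (stoppedAt S τ (n + m))) P :=
    fun m => (hT.integrable _).indicator (hU m).compl
  have hnn_ind : ∀ m, 0 ≤ᵐ[P] (U m)ᶜ.indicator (stoppedAt S τ (n + m)) := by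
    intro m
    filter_upwards [hTpos] with ω hω
    exact indicator_apply_nonneg fun _ => hω _
  have hfatou : ENNReal.ofReal (∫ ω, evalAt S Sinf τ ω ∂P) ≤
      ENNReal.ofReal (∫ ω, S 0 ω ∂P - c) := by
    rw [ofReal_integral_eq_lintegral_ofReal hint hnonneg]
    calc ∫⁻ ω, ENNReal.ofReal (evalAt S Sinf τ ω) ∂P
        = ∫⁻ ω, liminf (fun m => ENNReal.ofReal
            ((U m)ᶜ.indicator (stoppedAt S τ (n + m)) ω)) atTop ∂P := by
          refine lintegral_congr_ae ?_
          filter_upwards [hlim] with ω hω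
          exact (ENNReal.tendsto_ofReal hω).liminf_eq.symm
      _ ≤ liminf (fun m => ∫⁻ ω, ENNReal.ofReal
            ((U m)ᶜ.indicator (stoppedAt S τ (n + m)) ω) ∂P) atTop :=
          lintegral_liminf_le' fun m => (hint_ind m).aemeasurable.ennreal_ofReal
      _ ≤ ENNReal.ofReal (∫ ω, S 0 ω ∂P - c) := by
          refine liminf_le_of_frequently_le' (Frequently.of_forall fun m => ?_)
          rw [← ofReal_integral_eq_lintegral_ofReal (hint_ind m) (hnn_ind m)]
          exact ENNReal.ofReal_le_ofReal (hbound m)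
  have hle := (integral_nonneg_of_ae (hnn_ind 0)).trans (hbound 0)
  linarith [(ENNReal.ofReal_le_ofReal_iff hle).1 hfatou]

end MassLoss

section Summability

/-- The integral test, with step size `δ`. -/
theorem AntitoneOn.summable_comp_add_mul {f : ℝ → ℝ} {t δ : ℝ} (hδ : 0 < δ)
    (hf : AntitoneOn f (Ici t)) (hnonneg : ∀ u ∈ Ici t, 0 ≤ f u)
    (hint : IntegrableOn f (Ici t)) : Summable fun m : ℕ => f (t + m * δ) := by
  have hmaps : ∀ s, 0 ≤ s → t + s * δ ∈ Ici t := fun s hs => by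
    simpa using mul_nonneg hs hδ.le
  rw [← summable_nat_add_iff 1]
  refine summable_of_sum_range_le (c := δ⁻¹ * ∫ u in Ici t, f u)
    (fun m => hnonneg _ (hmaps _ (by positivity))) fun k => ?_
  have hanti : AntitoneOn (fun s => f (t + s * δ)) (Icc 0 (0 + (k : ℝ))) := fun a ha b hb hab =>
    hf (hmaps a ha.1) (hmaps b hb.1) (by gcongr)
  have hsum := hanti.sum_le_integral
  simp only [zero_add] at hsum
  refine hsum.trans ?_
  have hsub : ∫ s in (0 : ℝ)..k, f (t + s * δ) = δ⁻¹ * ∫ u in t..(t + k * δ), f u := by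
    have := intervalIntegral.integral_comp_add_mul (a := 0) (b := (k : ℝ)) f hδ.ne' t
    simpa [mul_comm] using this
  rw [hsub, intervalIntegral.integral_of_le (by simpa using mul_nonneg k.cast_nonneg hδ.le)]
  gcongr
  · exact (ae_restrict_iff' measurableSet_Ici).2 (ae_of_all _ hnonneg)
  · exact Ioc_subset_Ioi_self.trans Ioi_subset_Ici_self

end Summability

namespace MarkovMartingale

open ProbabilityTheory

variable {Ω : Type*} [MeasurableSpace Ω] (M : MarkovMartingale Ω) {x : ℝ}

theorem measurable_S (hx : 0 < x) (n : ℕ) : Measurable (M.S n) :=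
  (((M.mart x hx).stronglyMeasurable n).mono (M.F.le n)).measurable

theorem map_pair_restrict (hx : 0 < x) (n : ℕ) {A : Set Ω} (hA : MeasurableSet[M.F n] A) :
    ((M.P x).restrict A).map (fun ω => (M.S n ω, M.S (n + 1) ω)) =
      (((M.P x).restrict A).map (M.S n)).compProd M.K := by
  have := M.prob x hx
  have := M.markov
  have hadapted := (M.mart x hx).stronglyAdapted
  have hmeas := M.measurable_S hx
  refine Measure.ext_prod fun {B C} hB hC => ?_
  have hAB : MeasurableSet[M.F n] (A ∩ M.S n ⁻¹' B) := hA.inter ((hadapted n).measurable hB)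
  have hAB' : MeasurableSet (A ∩ M.S n ⁻¹' B) := M.F.le n _ hAB
  rw [Measure.compProd_apply_prod hB hC, setLIntegral_map hB (M.K.measurable_coe hC) (hmeas n),
    Measure.restrict_restrict (hmeas n hB), inter_comm,
    Measure.map_apply ((hmeas n).prodMk (hmeas (n + 1))) (hB.prod hC),
    Measure.restrict_apply (((hmeas n).prodMk (hmeas (n + 1))) (hB.prod hC))]
  have hstep := M.step x hx n (C.indicator 1) (measurable_one.indicator hC)
    ⟨1, fun y => by by_cases hy : y ∈ C <;> simp [hy]⟩
  have hind : (fun ω => C.indicator (1 : ℝ → ℝ) (M.S (n + 1) ω)) =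
      (M.S (n + 1) ⁻¹' C).indicator 1 := by
    rfl
  have hC' := hmeas (n + 1) hC
  have hint : Integrable (fun ω => C.indicator (1 : ℝ → ℝ) (M.S (n + 1) ω)) (M.P x) := by
    rw [hind]; exact (integrable_const (1 : ℝ)).indicator hC'
  have hreal := setIntegral_condExp (M.F.le n) hint hAB
  rw [setIntegral_congr_ae hAB' (hstep.mono fun ω h _ => h), hind, integral_indicator hC',
    Measure.restrict_restrict hC'] at hreal
  simp only [integral_indicator hC, Pi.one_apply, integral_const, smul_eq_mul, mul_one,
    measureReal_restrict_apply_univ] at hreal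
  rw [integral_eq_lintegral_of_nonneg_ae (ae_of_all _ fun _ => measureReal_nonneg)
    ((M.K.measurable_coe hC).ennreal_toReal.comp (hmeas n)).aestronglyMeasurable] at hreal
  simp only [measureReal_def, ENNReal.ofReal_toReal (measure_ne_top _ _)] at hreal
  have hfin : ∫⁻ ω in A ∩ M.S n ⁻¹' B, M.K (M.S n ω) C ∂M.P x ≠ ⊤ := by
    refine ((lintegral_mono fun ω => prob_le_one).trans_lt ?_).ne
    simp
  rw [ENNReal.toReal_eq_toReal_iff' hfin (measure_ne_top _ _)] at hreal
  rw [hreal]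
  congr 1
  ext ω
  simp only [mem_inter_iff, mem_preimage, mem_prod]
  tauto

variable {ε : ℝ}

theorem bEps_nonneg (hx : 0 < x) : 0 ≤ M.bEps ε x :=
  mul_nonneg (by positivity) (setIntegral_nonneg measurableSet_Ico fun _ hy => hy.1)

theorem setIntegral_lt_le (hx : 0 < x) (n : ℕ) {A : Set Ω} (hA : MeasurableSet[M.F n] A) {β : ℝ}
    (hβ : 0 ≤ β) (hb : ∀ ω ∈ A, M.bEps ε (M.S n ω) ≤ β) :
    ∫ ω in A ∩ {ω | M.S (n + 1) ω < (1 + ε) * M.S n ω}, M.S (n + 1) ω ∂M.P x ≤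
      β * ∫ ω in A, M.S n ω ∂M.P x := by
  have := M.prob x hx
  have := M.markov
  have hmart := M.mart x hx
  have hmeas := M.measurable_S hx
  have hpos := M.pos x hx
  have hA' := M.F.le n _ hA
  have hD : MeasurableSet {ω | M.S (n + 1) ω < (1 + ε) * M.S n ω} :=
    measurableSet_lt (hmeas _) ((hmeas n).const_mul _)
  have hE : MeasurableSet {p : ℝ × ℝ | p.2 < (1 + ε) * p.1} :=
    measurableSet_lt measurable_snd (measurable_fst.const_mul _)
  have hh : Measurable ({p : ℝ × ℝ | p.2 < (1 + ε) * p.1}.indicator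
      fun p => ENNReal.ofReal p.2) := measurable_snd.ennreal_ofReal.indicator hE
  have hkernel : ∀ s, 0 < s → ∫⁻ y, {p : ℝ × ℝ | p.2 < (1 + ε) * p.1}.indicator
      (fun p => ENNReal.ofReal p.2) (s, y) ∂M.K s = ENNReal.ofReal (s * M.bEps ε s) := by
    intro s hs
    have hb : s * M.bEps ε s = ∫ y in Ico 0 (s * (1 + ε)), y ∂M.K s := by
      rw [bEps]; field_simp
    have hint : Integrable (fun y => y) ((M.K s).restrict (Ico 0 (s * (1 + ε)))) :=
      (M.kernel_int s hs).integrableOn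
    rw [hb, ofReal_integral_eq_lintegral_ofReal hint
      ((ae_restrict_iff' measurableSet_Ico).2 (ae_of_all _ fun y hy => hy.1)),
      ← lintegral_indicator measurableSet_Ico]
    refine lintegral_congr fun y => ?_
    by_cases hy : y < (1 + ε) * s <;> by_cases hy0 : 0 ≤ y <;>
      simp [indicator, hy, hy0, mul_comm s]
    all_goals exact (not_le.1 hy0).le
  have hlhs : ENNReal.ofReal (∫ ω in A ∩ {ω | M.S (n + 1) ω < (1 + ε) * M.S n ω},
      M.S (n + 1) ω ∂M.P x) = ∫⁻ ω in A, ENNReal.ofReal (M.S n ω * M.bEps ε (M.S n ω)) ∂M.P x := by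
    rw [ofReal_integral_eq_lintegral_ofReal (hmart.integrable _).integrableOn
      (ae_restrict_of_ae (hpos.mono fun ω h => (h _).le)), inter_comm,
      ← Measure.restrict_restrict hD, ← lintegral_indicator hD]
    have hpair := lintegral_map (μ := (M.P x).restrict A) hh
      ((hmeas n).prodMk (hmeas (n + 1)))
    rw [M.map_pair_restrict hx n hA, Measure.lintegral_compProd hh,
      lintegral_map hh.lintegral_kernel_prod_right' (hmeas n)] at hpair
    refine Eq.trans ?_ (hpair.symm.trans (lintegral_congr_ae (ae_restrict_of_ae ?_)))
    · rfl
    · filter_upwards [hpos] with ω hω using hkernel _ (hω n)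
  have hle : ∫⁻ ω in A, ENNReal.ofReal (M.S n ω * M.bEps ε (M.S n ω)) ∂M.P x ≤
      ENNReal.ofReal (β * ∫ ω in A, M.S n ω ∂M.P x) := by
    rw [ENNReal.ofReal_mul hβ, ofReal_integral_eq_lintegral_ofReal
      (hmart.integrable _).integrableOn (ae_restrict_of_ae (hpos.mono fun ω h => (h _).le)),
      ← lintegral_const_mul _ (hmeas n).ennreal_ofReal]
    refine lintegral_mono_ae ?_
    rw [ae_restrict_iff' hA']
    filter_upwards [hpos] with ω hω hωA
    rw [← ENNReal.ofReal_mul hβ, mul_comm]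
    exact ENNReal.ofReal_le_ofReal (mul_le_mul_of_nonneg_right (hb ω hωA) (hω n).le)
  have hrhs : 0 ≤ β * ∫ ω in A, M.S n ω ∂M.P x :=
    mul_nonneg hβ (integral_nonneg_of_ae (ae_restrict_of_ae (hpos.mono fun ω h => (h _).le)))
  exact (ENNReal.ofReal_le_ofReal_iff hrhs).1 (hlhs.trans_le hle)

theorem half_le_setIntegral_growthEvent (hx : 0 < x) (hε : 0 < ε) {y : ℝ} (hy : 0 < y)
    (hanti : AntitoneOn (M.bEps ε) (Ici y))
    (hsum : ∀ m, ∑ i ∈ Finset.range m, M.bEps ε (y * (1 + ε) ^ i) ≤ 1 / 2) (n m : ℕ) :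
    (1 / 2) * ∫ ω in {ω | y ≤ M.S n ω}, M.S n ω ∂M.P x ≤
      ∫ ω in growthEvent M.S y (1 + ε) n m, M.S (n + m) ω ∂M.P x := by
  have := M.prob x hx
  have hmart := M.mart x hx
  have hpos := M.pos x hx
  set U := growthEvent M.S y (1 + ε) n
  set L : ℕ → ℝ := fun m => ∫ ω in U m, M.S (n + m) ω ∂M.P x
  set β : ℕ → ℝ := fun i => M.bEps ε (y * (1 + ε) ^ i)
  have hU : ∀ m, MeasurableSet[M.F (n + m)] (U m) :=
    measurableSet_growthEvent hmart.stronglyAdapted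
  have hnn : ∀ (A : Set Ω) k, 0 ≤ ∫ ω in A, M.S k ω ∂M.P x := fun A k =>
    integral_nonneg_of_ae (ae_restrict_of_ae (hpos.mono fun ω h => (h _).le))
  have hL0 : L 0 = ∫ ω in {ω | y ≤ M.S n ω}, M.S n ω ∂M.P x := by
    simp [L, U, growthEvent_zero]
  have hsplit : ∀ m, L m = ∫ ω in U m ∩ {ω | M.S (n + m + 1) ω < (1 + ε) * M.S (n + m) ω},
      M.S (n + m + 1) ω ∂M.P x + L (m + 1) := by
    intro m
    have hD : MeasurableSet {ω | M.S (n + m + 1) ω < (1 + ε) * M.S (n + m) ω} :=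
      measurableSet_lt (M.measurable_S hx _) ((M.measurable_S hx _).const_mul _)
    have hU_succ : U (m + 1) = U m \ {ω | M.S (n + m + 1) ω < (1 + ε) * M.S (n + m) ω} := by
      ext ω
      simp [U, growthEvent_succ]
    have h1 : L m = ∫ ω in U m, M.S (n + m + 1) ω ∂M.P x :=
      hmart.setIntegral_eq (Nat.le_succ _) (hU m)
    simp only [h1, L, hU_succ]
    exact (integral_inter_add_sdiff hD (hmart.integrable _).integrableOn).symm
  have hL_le : ∀ m, L m ≤ L 0 := by
    intro m
    induction m with
    | zero => exact le_rfl
    | succ m ih => linarith [hsplit m, hnn (U m ∩ {ω | M.S (n + m + 1) ω <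
        (1 + ε) * M.S (n + m) ω}) (n + m + 1)]
  have hy_le : ∀ m, y ≤ y * (1 + ε) ^ m := fun m =>
    le_mul_of_one_le_right hy.le (one_le_pow₀ (by linarith))
  have hβ : ∀ m, 0 ≤ β m := fun m => M.bEps_nonneg (hy.trans_le (hy_le m))
  have hrec : ∀ m, L m - β m * L 0 ≤ L (m + 1) := by
    intro m
    have h1 := M.setIntegral_lt_le hx (n + m) (hU m) (hβ m) fun ω hω => by
      have h := mul_pow_le_of_mem_growthEvent (by linarith) hω
      exact hanti (hy_le m) ((hy_le m).trans h) h
    have h2 : β m * L m ≤ β m * L 0 := mul_le_mul_of_nonneg_left (hL_le m) (hβ m)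
    linarith [hsplit m]
  have hlow : ∀ m, (1 - ∑ i ∈ Finset.range m, β i) * L 0 ≤ L m := by
    intro m
    induction m with
    | zero => simp
    | succ m ih =>
      rw [Finset.sum_range_succ]
      linarith [hrec m]
  rw [← hL0]
  refine le_trans ?_ (hlow m)
  have := hsum m
  refine mul_le_mul_of_nonneg_right (by linarith) (hnn _ _)

theorem exists_sum_bEps_le {xb : ℝ} (hε : 0 < ε) (hxb : 0 < xb)
    (hmono : AntitoneOn (M.bEps ε) (Ici xb))
    (hint : IntegrableOn (fun u => M.bEps ε (Real.exp u)) (Ici (Real.log xb))) :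
    ∃ y, xb ≤ y ∧ ∀ m, ∑ i ∈ Finset.range m, M.bEps ε (y * (1 + ε) ^ i) ≤ 1 / 2 := by
  have hq : 0 < 1 + ε := by linarith
  have hlog : ∀ u ∈ Ici (Real.log xb), xb ≤ Real.exp u := fun u hu =>
    (Real.log_le_iff_le_exp hxb).1 hu
  have hsummable : Summable fun m : ℕ => M.bEps ε (xb * (1 + ε) ^ m) := by
    have := AntitoneOn.summable_comp_add_mul (Real.log_pos (by linarith : 1 < 1 + ε))
      (fun u hu v hv huv => hmono (hlog u hu) (hlog v hv) (Real.exp_le_exp.2 huv))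
      (fun u _ => M.bEps_nonneg (Real.exp_pos u)) hint
    simpa [Real.exp_add, Real.exp_log hxb, Real.exp_nat_mul, Real.exp_log hq] using this
  obtain ⟨N, hN⟩ := ((tendsto_sum_nat_add fun m : ℕ =>
    M.bEps ε (xb * (1 + ε) ^ m)).eventually_lt_const (by norm_num : (0 : ℝ) < 1 / 2)).exists
  refine ⟨xb * (1 + ε) ^ N, le_mul_of_one_le_right hxb.le (one_le_pow₀ (by linarith)),
    fun m => le_trans ?_ hN.le⟩
  have h := ((summable_nat_add_iff N).2 hsummable).sum_le_tsum (Finset.range m)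
    fun i _ => M.bEps_nonneg (by positivity)
  refine le_trans (le_of_eq (Finset.sum_congr rfl fun i _ => ?_)) h
  rw [mul_assoc, ← pow_add, add_comm N]

end MarkovMartingale

/-- Under the lower bound assumption on `a`, if for some `ε > 0` the function
`b_ε` is nonincreasing on `[x_b, ∞)` and `∫_{log x_b}^∞ b_ε(e^u) du < ∞`, then `S` is a bubble
under `P_x` for every `x > 0` for which `S` is not `P_x`-a.s. bounded. -/
theorem MarkovMartingale.bubble_of_bEps_integrable
    {Ω : Type*} [MeasurableSpace Ω] (M : MarkovMartingale Ω)
    {xa : ℝ} (ha : M.ALowerBound xa)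
    {ε xb : ℝ} (hε : 0 < ε) (hxb : 0 < xb)
    (hmono : AntitoneOn (M.bEps ε) (Set.Ici xb))
    (hint : IntegrableOn (fun u => M.bEps ε (Real.exp u)) (Set.Ici (Real.log xb))) :
    ∀ x : ℝ, 0 < x → ¬ M.Bounded x → M.Bubble x := by
  intro x hx hunb
  have := M.prob x hx
  have hmart := M.mart x hx
  have hpos := M.pos x hx
  obtain ⟨y, hy, hsum⟩ := M.exists_sum_bEps_le hε hxb hmono hint
  have hy0 : 0 < y := hxb.trans_le hy
  obtain ⟨n, hn⟩ : ∃ n, ¬ ∀ᵐ ω ∂M.P x, M.S n ω ≤ y := by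
    by_contra! h
    exact hunb ⟨y, ae_all_iff.2 h⟩
  have hmass : 0 < ∫ ω in {ω | y ≤ M.S n ω}, M.S n ω ∂M.P x := by
    refine (setIntegral_pos_iff_support_of_nonneg_ae
      (ae_restrict_of_ae (hpos.mono fun ω h => (h n).le)) (hmart.integrable n).integrableOn).2 ?_
    refine pos_of_ne_zero fun h0 => hn ?_
    rw [ae_iff]
    refine measure_mono_null (fun ω hω => ?_) h0
    have hlt : y < M.S n ω := not_le.1 hω
    exact ⟨(hy0.trans hlt).ne', hlt.le⟩
  have hstart : ∫ ω, M.S 0 ω ∂M.P x = x := by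
    rw [integral_congr_ae (M.start x hx)]
    simp
  exact ⟨n, integral_evalAt_lt hmart hpos (hstart.symm ▸ hx : 0 < ∫ ω, M.S 0 ω ∂M.P x) (M.conv x hx)
    (isStoppingTime_drawdown hmart.stronglyAdapted (n + 1))
    (fun m => M.F.le _ _ (measurableSet_growthEvent hmart.stronglyAdapted m))
    ((M.conv x hx).mono fun ω h => eventually_notMem_growthEvent hy0 (by linarith) h)
    (fun m ω hω => stoppedAt_drawdown_of_mem_growthEvent hy0.le (by linarith) hω)
    (half_pos hmass)
    (fun m => le_of_eq_of_le (by ring) (M.half_le_setIntegral_growthEvent hx hε hy0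
      (hmono.mono (Ici_subset_Ici.2 hy)) hsum n m))⟩
end
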